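/- Probabilistic non-contextuality implies logical (possibilistic) non-contextuality: let e = {e_C}_{C∈M} be an ℝ≥0-empirical model on a finite measurement scenario ⟨X, M, (O_m)⟩. If e is non-contextual, i.e. there is a distribution d : E(X) → ℝ≥0 with Σ_{g} d(g) = 1 and d↓C = e_C for all C ∈ M, then its possibilistic collapse is non-contextual: the Boolean-valued function d̃ = χ_{supp(d)} : E(X) → {0,1} satisfies, for every C ∈ M and x ∈ E(C), (⋁_{g∈E(X), g|_C = x} d̃(g)) = ẽ_C(x), where ẽ_C = χ_{supp(e_C)}; in particular d̃ is a global section for the possibilistic model {ẽ_C}_{C∈M} over the Boolean semiring. Equivalently: logical contextuality implies probabilistic contextuality. -/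

import Mathlib

open scoped NNReal

/-- Events (tuples of outcomes) over a finite set `U` of measurements. -/
abbrev Event {X : Type*} (O : X → Type*) (U : Finset X) : Type _ :=
  ∀ m : U, O m.1

/-- Restriction (cartesian projection) of an event to a smaller set. -/
def res {X : Type*} {O : X → Type*} {U U' : Finset X} (h : U ⊆ U')
    (y : Event O U') : Event O U :=
  fun m => y ⟨m.1, h m.2⟩

/-- Marginalization of a nonnegative-real potential. -/
noncomputable def marginal {X : Type*} [DecidableEq X] {O : X → Type*}
    [∀ m, Fintype (O m)] [∀ m, DecidableEq (O m)]
    {U U' : Finset X} (h : U ⊆ U') (d : Event O U' → ℝ≥0) : Event O U → ℝ≥0 :=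
  fun x => ∑ y : Event O U', if res h y = x then d y else 0

/-- The Boolean join over a finite set is true exactly when some member is. -/
theorem finset_sup_bool_eq_true_iff {α : Type*} (s : Finset α) (f : α → Bool) :
    s.sup f = true ↔ ∃ a ∈ s, f a = true := by
  classical
  induction s using Finset.induction_on with
  | empty => simp
  | insert a s _ ih => simp [Finset.sup_insert, ih]

/-- The support of a marginal is the image of the support under restriction. -/
theorem marginal_ne_zero_iff {X : Type*} [DecidableEq X] {O : X → Type*}
    [∀ m, Fintype (O m)] [∀ m, DecidableEq (O m)]
    {U U' : Finset X} (h : U ⊆ U') (d : Event O U' → ℝ≥0) (x : Event O U) :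
    marginal h d x ≠ 0 ↔ ∃ y, res h y = x ∧ d y ≠ 0 := by
  simp [marginal, Finset.sum_eq_zero_iff]

/-- **Statement 15.** Probabilistic non-contextuality implies logical
(possibilistic) non-contextuality: if the `ℝ≥0`-empirical model
`e = {e C}_{C ∈ M}` has a global distribution `d` with `d↓C = e C` for all
`C ∈ M`, then the Boolean possibilistic collapse `d̃ = χ_supp(d)` Boolean-
marginalizes to `ẽ C = χ_supp(e C)` on every context: for all `C ∈ M` and
`x ∈ E(C)`, `⋁_{g|_C = x} d̃ g = ẽ C x`.  Hence `d̃` is a global section of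
the possibilistic collapse over the Boolean semiring; equivalently, logical
contextuality implies probabilistic contextuality. -/
theorem probabilistic_noncontextual_implies_possibilistic
    {X : Type*} [DecidableEq X] [Fintype X]
    (O : X → Type*) [∀ m, Fintype (O m)] [∀ m, DecidableEq (O m)]
    [∀ m, Nonempty (O m)]
    (M : Finset (Finset X)) (hM : M.Nonempty)
    (hcover : ∀ m : X, ∃ C ∈ M, m ∈ C)
    (e : (C : Finset X) → Event O C → ℝ≥0)
    (hnorm : ∀ C ∈ M, ∑ x : Event O C, e C x = 1)
    (hcompat : ∀ C ∈ M, ∀ C' ∈ M,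
      marginal (Finset.inter_subset_left (s₁ := C) (s₂ := C')) (e C)
        = marginal (Finset.inter_subset_right (s₁ := C) (s₂ := C')) (e C'))
    (d : Event O (Finset.univ : Finset X) → ℝ≥0)
    (hd1 : ∑ g, d g = 1)
    (hd2 : ∀ C ∈ M, marginal (Finset.subset_univ C) d = e C) :
    ∀ C ∈ M, ∀ x : Event O C,
      (Finset.univ.filter
          (fun g : Event O (Finset.univ : Finset X) =>
            res (Finset.subset_univ C) g = x)).sup
        (fun g => decide (d g ≠ 0))
      = decide (e C x ≠ 0) := by
  intro C hC x
  rw [Bool.eq_iff_iff, finset_sup_bool_eq_true_iff, ← hd2 C hC, decide_eq_true_iff,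
    marginal_ne_zero_iff]
  simp only [Finset.mem_filter, Finset.mem_univ, true_and, decide_eq_true_iff]
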